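/- (Reproducing formula for higher differences.) Let X be a vector space, f:[0,1)→X, r∈ℕ, and h,s>0. Then for every t with 0 ≤ t ≤ 1−rh−r²s (so that all points involved lie in [0,1)), one has the identity Δ_h^r f(t) = Σ_{l=1}^r (−1)^l binom(r,l) [ Δ_{ls}^r f(t+lh) − Δ_{h+ls}^r f(t) ]. -/

import Mathlib

noncomputable section

/-- r-th order forward difference with step `h`, for a vector-space-valued function. -/
def idelta {X : Type*} [AddCommGroup X] [Module ℝ X] (r : ℕ) (h : ℝ) (f : ℝ → X) (t : ℝ) : X :=
  ∑ i ∈ Finset.range (r + 1), ((-1 : ℝ) ^ (r - i) * (r.choose i)) • f (t + (i : ℝ) * h)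

theorem idelta_eq_neg_one_pow_mul {X : Type*} [AddCommGroup X] [Module ℝ X] (r : ℕ) (h : ℝ)
    (f : ℝ → X) (t : ℝ) :
    idelta r h f t = ∑ i ∈ Finset.range (r + 1),
      ((-1 : ℝ) ^ r * ((-1 : ℝ) ^ i * (r.choose i))) • f (t + (i : ℝ) * h) := by
  refine Finset.sum_congr rfl fun i hi => ?_
  have hir : i ≤ r := Nat.lt_succ_iff.mp (Finset.mem_range.mp hi)
  have hsign : (-1 : ℝ) ^ (r - i) = (-1) ^ r * (-1) ^ i := by
    conv_rhs => rw [← Nat.sub_add_cancel hir, pow_add, mul_assoc, ← mul_pow]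
    simp
  rw [hsign, mul_assoc]

theorem idelta_zero_step {X : Type*} [AddCommGroup X] [Module ℝ X] {r : ℕ} (hr : r ≠ 0)
    (f : ℝ → X) (t : ℝ) : idelta r 0 f t = 0 := by
  have hsum : ∑ i ∈ Finset.range (r + 1), (-1 : ℝ) ^ i * (r.choose i) = 0 := by
    exact_mod_cast Int.alternating_sum_range_choose_of_ne hr
  simp only [idelta_eq_neg_one_pow_mul, mul_zero, add_zero]
  rw [← Finset.sum_smul, ← Finset.mul_sum, hsum, mul_zero, zero_smul]

/-- The double sums obtained by differencing along either direction of the grid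
`t + l * h + i * l * s` agree. -/
theorem sum_smul_idelta_comm {X : Type*} [AddCommGroup X] [Module ℝ X] (f : ℝ → X) (r : ℕ)
    (h s t : ℝ) :
    ∑ l ∈ Finset.range (r + 1), ((-1 : ℝ) ^ l * (r.choose l)) •
        idelta r ((l : ℝ) * s) f (t + (l : ℝ) * h) =
      ∑ l ∈ Finset.range (r + 1), ((-1 : ℝ) ^ l * (r.choose l)) •
        idelta r (h + (l : ℝ) * s) f t := by
  simp only [idelta_eq_neg_one_pow_mul, Finset.smul_sum, smul_smul]
  rw [Finset.sum_comm]
  refine Finset.sum_congr rfl fun i _ => Finset.sum_congr rfl fun l _ => ?_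
  congr 1
  · ring
  · congr 1
    ring

/-- Reproducing formula for higher differences. -/
theorem stmt5 {X : Type*} [AddCommGroup X] [Module ℝ X] (f : ℝ → X) (r : ℕ) (hr : 0 < r)
    (h s : ℝ) (hh : 0 < h) (hs : 0 < s) (t : ℝ) (ht0 : 0 ≤ t)
    (ht1 : t ≤ 1 - (r : ℝ) * h - (r : ℝ) ^ 2 * s) :
    idelta r h f t =
      ∑ l ∈ Finset.Icc 1 r, ((-1 : ℝ) ^ l * (r.choose l)) •
        (idelta r ((l : ℝ) * s) f (t + (l : ℝ) * h) - idelta r (h + (l : ℝ) * s) f t) := by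
  have key : ∑ l ∈ Finset.range (r + 1), ((-1 : ℝ) ^ l * (r.choose l)) •
      (idelta r ((l : ℝ) * s) f (t + (l : ℝ) * h) - idelta r (h + (l : ℝ) * s) f t) = 0 := by
    simp only [smul_sub, Finset.sum_sub_distrib]
    rw [sum_smul_idelta_comm, sub_self]
  rw [Finset.range_eq_Ico, Finset.sum_eq_sum_Ico_succ_bot (Nat.succ_pos r)] at key
  simp only [Nat.cast_zero, zero_mul, add_zero, pow_zero, Nat.choose_zero_right, Nat.cast_one,
    mul_one, one_smul, idelta_zero_step hr.ne', zero_sub] at key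
  exact neg_add_eq_zero.mp key
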